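/- Let α be a negative integer with -α ≤ n and let β > -1. Then for every i with -α ≤ i ≤ n and all real x, the generalized Jacobi polynomial Ĵ_i^{(α,β)}(x) := (1-x)^{-α} R_{i+α}^{(-α,β)}(x) satisfies Ĵ_i^{(α,β)}(x) = Σ_{h=0}^{n+α} C(n,h)^{-1} C(n+α, h) a_{i+α, h}^{(n+α, -α, β)} B_h^n(x). -/

import Mathlib

open Finset

/-- Pochhammer symbol `(x)_m = x (x+1) ⋯ (x+m-1)`. -/
noncomputable def poch (x : ℝ) (m : ℕ) : ℝ := ∏ j ∈ Finset.range m, (x + j)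

/-- Bernstein polynomial `B_j^n(x) = C(n,j) x^j (1-x)^(n-j)`. -/
noncomputable def bern (n j : ℕ) (x : ℝ) : ℝ := (n.choose j : ℝ) * x ^ j * (1 - x) ^ (n - j)

/-- Shifted Jacobi polynomial `R_i^(a,b)(x)`. -/
noncomputable def shiftedJacobi (a b : ℝ) (i : ℕ) (x : ℝ) : ℝ :=
  poch (a + 1) i / (Nat.factorial i : ℝ) *
    ∑ j ∈ Finset.range (i + 1),
      poch (-(i : ℝ)) j * poch ((i : ℝ) + a + b + 1) j /
        ((Nat.factorial j : ℝ) * poch (a + 1) j) * (1 - x) ^ j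

/-- Hahn polynomial `Q_m(t; a, b, N)`. -/
noncomputable def hahnQ (m : ℕ) (t : ℝ) (a b : ℝ) (N : ℕ) : ℝ :=
  ∑ j ∈ Finset.range (m + 1),
    poch (-(m : ℝ)) j * poch ((m : ℝ) + a + b + 1) j * poch (-t) j /
      ((Nat.factorial j : ℝ) * poch (a + 1) j * poch (-(N : ℝ)) j)

/-- Dual Hahn polynomial `R_m(λ(t); a, b, N)` with `λ(t) = t(t+a+b+1)`. -/
noncomputable def dualHahnR (m : ℕ) (t : ℝ) (a b : ℝ) (N : ℕ) : ℝ :=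
  ∑ j ∈ Finset.range (m + 1),
    poch (-(m : ℝ)) j * poch (t + a + b + 1) j * poch (-t) j /
      ((Nat.factorial j : ℝ) * poch (a + 1) j * poch (-(N : ℝ)) j)

/-- Modified Jacobi polynomial `J_{i,k,l}^(α,β)(x) = (1-x)^l x^k R_{i-k-l}^(α+2l,β+2k)(x)`. -/
noncomputable def modJacobi (α β : ℝ) (k l i : ℕ) (x : ℝ) : ℝ :=
  (1 - x) ^ l * x ^ k * shiftedJacobi (α + 2 * l) (β + 2 * k) (i - k - l) x

/-- Connection coefficient `c_{ih}` of the Bernstein form of the modified Jacobi polynomials. -/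
noncomputable def cCoef (α β : ℝ) (n k l i h : ℕ) : ℝ :=
  poch (α + 2 * l + 1) (i - k - l) / (Nat.factorial (i - k - l) : ℝ) *
    (n.choose h : ℝ)⁻¹ * ((n - k - l).choose (h - k) : ℝ) *
    hahnQ (i - k - l) ((n : ℝ) - l - h) (α + 2 * l) (β + 2 * k) (n - k - l)

/-- The quantity `z_{hi}`. -/
noncomputable def zCoef (α β : ℝ) (n k l h i : ℕ) : ℝ :=
  (n.choose h : ℝ) * (2 * (i : ℝ) + (α + β + 1)) * poch ((k : ℝ) + l - n) (i - k - l) *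
      poch (α + 2 * l + 1) (n - l - h) * poch (β + 2 * k + 1) (h - k) /
    (poch (α + 2 * l + 1) (i - k - l) * poch ((i : ℝ) + k + l + (α + β + 1)) (n + 1 - k - l))

/-- The quantity `w_{hi}`. -/
noncomputable def wCoef (α β : ℝ) (n k l h i : ℕ) : ℝ :=
  hahnQ (i - k - l) ((h : ℝ) - k) (β + 2 * k) (α + 2 * l) (n - k - l)

/-- Connection coefficient `d_{hi}` of the modified Jacobi form of Bernstein polynomials. -/
noncomputable def dCoef (α β : ℝ) (n k l h i : ℕ) : ℝ := zCoef α β n k l h i * wCoef α β n k l h i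

/-- Coefficient `a_{ih}^(m,a,b) = (-1)^i ((b+1)_i / i!) Q_i(h; b, a, m)`. -/
noncomputable def aCoef (m : ℕ) (a b : ℝ) (i h : ℕ) : ℝ :=
  (-1 : ℝ) ^ i * poch (b + 1) i / (Nat.factorial i : ℝ) * hahnQ i (h : ℝ) b a m

/-- Coefficient `b_{hi}^(m,a,b)`. -/
noncomputable def bCoef (m : ℕ) (a b : ℝ) (h i : ℕ) : ℝ :=
  (m.choose h : ℝ) * (2 * (i : ℝ) + a + b + 1) * poch (-(m : ℝ)) i * poch (a + 1) (m - h) *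
      poch (b + 1) h / (poch (a + 1) i * poch ((i : ℝ) + a + b + 1) (m + 1)) *
    hahnQ i (h : ℝ) b a m

theorem poch_succ (x : ℝ) (m : ℕ) : poch x (m + 1) = poch x m * (x + m) := by
  simp [poch, Finset.prod_range_succ]

theorem poch_succ' (x : ℝ) (m : ℕ) : poch x (m + 1) = x * poch (x + 1) m := by
  unfold poch
  rw [Finset.prod_range_succ', mul_comm]
  simp only [Nat.cast_zero, add_zero, Nat.cast_add, Nat.cast_one]
  congr 1
  exact Finset.prod_congr rfl fun j _ => by ring

theorem poch_add (x : ℝ) (j k : ℕ) : poch x (j + k) = poch x j * poch (x + j) k := by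
  unfold poch
  rw [Finset.prod_range_add]
  congr 1
  exact Finset.prod_congr rfl fun i _ => by push_cast; ring

theorem poch_pos {x : ℝ} (hx : 0 < x) (m : ℕ) : 0 < poch x m :=
  Finset.prod_pos fun _ _ => by positivity

theorem poch_neg_natCast (m j : ℕ) :
    poch (-(m : ℝ)) j = (-1) ^ j * (Nat.factorial j : ℝ) * (m.choose j : ℝ) := by
  rw [mul_assoc, ← Nat.cast_mul, ← Nat.descFactorial_eq_factorial_mul_choose]
  induction j with
  | zero => simp [poch]
  | succ j ih =>
    rw [poch_succ, ih, Nat.descFactorial_succ]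
    rcases le_or_gt j m with h | h
    · push_cast [Nat.cast_sub h]
      ring
    · simp [Nat.descFactorial_eq_zero_iff_lt.2 h]

/-- The terminating series `(d)_r · ₂F₁(-r, c; d; y)`, written without denominators. -/
noncomputable def hypSum (r : ℕ) (c d y : ℝ) : ℝ :=
  ∑ j ∈ Finset.range (r + 1),
    (r.choose j : ℝ) * ((-1) ^ j * poch c j * poch (d + j) (r - j) * y ^ j)

theorem hypSum_succ (r : ℕ) (c d y : ℝ) :
    hypSum (r + 1) c d y = (d + r) * hypSum r c d y - c * y * hypSum r (c + 1) (d + 1) y := by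
  unfold hypSum
  rw [Finset.sum_choose_succ_mul (fun j k => (-1) ^ j * poch c j * poch (d + j) k * y ^ j) r,
    Finset.mul_sum, Finset.mul_sum, sub_eq_add_neg, ← Finset.sum_neg_distrib]
  congr 1 <;> refine Finset.sum_congr rfl fun j hj => ?_
  · have hjr : j ≤ r := Nat.lt_succ_iff.1 (Finset.mem_range.1 hj)
    rw [Nat.succ_sub hjr, poch_succ, Nat.cast_sub hjr]
    ring
  · rw [poch_succ', show d + ((j + 1 : ℕ) : ℝ) = d + 1 + j by push_cast; ring]
    ring

theorem hypSum_contiguous (r : ℕ) (c e y : ℝ) :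
    (c - e) * hypSum r c (e + 1) y + (e + r) * hypSum r c e y = c * hypSum r (c + 1) (e + 1) y := by
  unfold hypSum
  rw [Finset.mul_sum, Finset.mul_sum, Finset.mul_sum, ← Finset.sum_add_distrib]
  refine Finset.sum_congr rfl fun j hj => ?_
  have hjr : j ≤ r := Nat.lt_succ_iff.1 (Finset.mem_range.1 hj)
  have hc : c * poch (c + 1) j = poch c j * (c + j) := by rw [← poch_succ', poch_succ]
  have he : (e + r) * poch (e + j) (r - j) = (e + j) * poch (e + 1 + j) (r - j) := by
    have h := (poch_succ' (e + j) (r - j)).symm.trans (poch_succ (e + j) (r - j))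
    rw [Nat.cast_sub hjr] at h
    rw [show e + 1 + (j : ℝ) = e + j + 1 by ring, h]
    ring
  linear_combination (r.choose j : ℝ) * (-1) ^ j * y ^ j * (poch c j * he
    - poch (e + 1 + j) (r - j) * hc)

theorem hypSum_one_sub (r : ℕ) (c d x : ℝ) :
    hypSum r c d (1 - x) = (-1) ^ r * hypSum r c (c - d - r + 1) x := by
  induction r generalizing c d with
  | zero => simp [hypSum, poch]
  | succ r ih =>
    rw [hypSum_succ, hypSum_succ, ih, ih]
    push_cast
    rw [show c - d - (r + 1 : ℝ) + 1 = c - d - r by ring,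
      show c + 1 - (d + 1) - (r : ℝ) + 1 = c - d - r + 1 by ring]
    linear_combination (-1) ^ r * hypSum_contiguous r c (c - d - r) x

theorem poch_mul_sum_eq_hypSum (r : ℕ) (c y : ℝ) {d : ℝ} (hd : 0 < d) :
    poch d r * ∑ j ∈ Finset.range (r + 1),
        poch (-(r : ℝ)) j * poch c j / ((Nat.factorial j : ℝ) * poch d j) * y ^ j =
      hypSum r c d y := by
  unfold hypSum
  rw [Finset.mul_sum]
  refine Finset.sum_congr rfl fun j hj => ?_
  obtain ⟨k, rfl⟩ := Nat.exists_eq_add_of_le (Nat.lt_succ_iff.1 (Finset.mem_range.1 hj))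
  have := (poch_pos hd j).ne'
  have := Nat.cast_ne_zero (R := ℝ).2 j.factorial_ne_zero
  rw [poch_neg_natCast, poch_add, Nat.add_sub_cancel_left]
  field_simp

theorem shiftedJacobi_eq_reflected {a b : ℝ} (ha : -1 < a) (hb : -1 < b) (r : ℕ) (x : ℝ) :
    shiftedJacobi a b r x = (-1) ^ r * poch (b + 1) r / (Nat.factorial r : ℝ) *
      ∑ j ∈ Finset.range (r + 1),
        poch (-(r : ℝ)) j * poch ((r : ℝ) + b + a + 1) j /
          ((Nat.factorial j : ℝ) * poch (b + 1) j) * x ^ j := by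
  have h := hypSum_one_sub r ((r : ℝ) + a + b + 1) (a + 1) x
  rw [show (r : ℝ) + a + b + 1 - (a + 1) - r + 1 = b + 1 by ring,
    ← poch_mul_sum_eq_hypSum r _ _ (by linarith), ← poch_mul_sum_eq_hypSum r _ _ (by linarith)] at h
  unfold shiftedJacobi
  rw [div_mul_eq_mul_div, h, add_right_comm (r : ℝ) a b]
  ring

theorem sum_choose_mul_choose_mul_pow {j m : ℕ} (hjm : j ≤ m) (x : ℝ) :
    ∑ h ∈ Finset.range (m + 1), (m.choose h : ℝ) * (h.choose j : ℝ) * x ^ h * (1 - x) ^ (m - h) =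
      (m.choose j : ℝ) * x ^ j := by
  obtain ⟨p, rfl⟩ := Nat.exists_eq_add_of_le hjm
  rw [add_assoc, Finset.sum_range_add, Finset.sum_eq_zero, zero_add]
  · have hbin : ∑ k ∈ Finset.range (p + 1), x ^ k * (1 - x) ^ (p - k) * (p.choose k : ℝ) = 1 := by
      rw [← add_pow]
      simp
    conv_rhs => rw [← mul_one ((_ : ℝ) * x ^ j), ← hbin, Finset.mul_sum]
    refine Finset.sum_congr rfl fun k _ => ?_
    have hch := Nat.choose_mul (n := j + p) (k := j + k) (s := j)
      (by omega)
    rw [Nat.add_sub_cancel_left, Nat.add_sub_cancel_left] at hch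
    rw [← Nat.cast_mul, hch, Nat.add_sub_add_left]
    push_cast
    ring
  · intro h hh
    simp [Nat.choose_eq_zero_of_lt (Finset.mem_range.1 hh)]

theorem shiftedJacobi_bernstein_form {a b : ℝ} (ha : -1 < a) (hb : -1 < b) {r m : ℕ} (hrm : r ≤ m)
    (x : ℝ) :
    shiftedJacobi a b r x =
      ∑ h ∈ Finset.range (m + 1), aCoef m a b r h * bern m h x := by
  rw [shiftedJacobi_eq_reflected ha hb]
  unfold aCoef hahnQ bern
  simp only [mul_assoc ((-1 : ℝ) ^ r * poch (b + 1) r / (Nat.factorial r : ℝ))]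
  rw [← Finset.mul_sum]
  congr 1
  simp only [Finset.sum_mul]
  rw [Finset.sum_comm]
  refine Finset.sum_congr rfl fun j hj => ?_
  have hjm : j ≤ m := (Nat.lt_succ_iff.1 (Finset.mem_range.1 hj)).trans hrm
  have hch : (m.choose j : ℝ) ≠ 0 := Nat.cast_ne_zero.2 (Nat.choose_pos hjm).ne'
  have hx : x ^ j = (m.choose j : ℝ)⁻¹ * ((m.choose j : ℝ) * x ^ j) := by field_simp
  rw [hx, ← sum_choose_mul_choose_mul_pow hjm, Finset.mul_sum, Finset.mul_sum]
  refine Finset.sum_congr rfl fun h _ => ?_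
  have := (poch_pos (show 0 < b + 1 by linarith) j).ne'
  have := Nat.cast_ne_zero (R := ℝ).2 j.factorial_ne_zero
  rw [poch_neg_natCast m, poch_neg_natCast h]
  field_simp

/-- Generalized Jacobi polynomials, case `α ∈ ℤ⁻`, `β > -1`: Bernstein form. -/
theorem genJacobi_bernstein_form_neg_alpha (n : ℕ) (α : ℤ) (hα : α < 0) (hαn : -α ≤ (n : ℤ))
    (β : ℝ) (hβ : -1 < β) :
    ∀ i : ℕ, -α ≤ (i : ℤ) → i ≤ n → ∀ x : ℝ,
      (1 - x) ^ (-α).toNat * shiftedJacobi ((-α : ℤ) : ℝ) β ((i : ℤ) + α).toNat x =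
        ∑ h ∈ Finset.Icc 0 ((n : ℤ) + α).toNat,
          (n.choose h : ℝ)⁻¹ * (((n : ℤ) + α).toNat.choose h : ℝ) *
            aCoef ((n : ℤ) + α).toNat ((-α : ℤ) : ℝ) β ((i : ℤ) + α).toNat h * bern n h x := by
  intro i hi hin x
  obtain ⟨A, rfl⟩ : ∃ A : ℕ, α = -(A : ℤ) := ⟨(-α).toNat, by omega⟩
  obtain ⟨m, rfl⟩ : ∃ m : ℕ, n = m + A := ⟨n - A, by omega⟩
  obtain ⟨r, rfl⟩ : ∃ r : ℕ, i = r + A := ⟨i - A, by omega⟩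
  rw [show (-(-(A : ℤ))).toNat = A by omega,
    show (((m + A : ℕ) : ℤ) + -(A : ℤ)).toNat = m by omega,
    show (((r + A : ℕ) : ℤ) + -(A : ℤ)).toNat = r by omega, neg_neg, Int.cast_natCast,
    shiftedJacobi_bernstein_form (by linarith [Nat.cast_nonneg (α := ℝ) A]) hβ
      (show r ≤ m by omega),
    Finset.mul_sum, ← Nat.range_succ_eq_Icc_zero]
  refine Finset.sum_congr rfl fun h hh => ?_
  have hhm : h ≤ m := Nat.lt_succ_iff.1 (Finset.mem_range.1 hh)
  have hch : ((m + A).choose h : ℝ) ≠ 0 := Nat.cast_ne_zero.2 (Nat.choose_pos (by omega)).ne'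
  unfold bern
  rw [Nat.sub_add_comm hhm, pow_add]
  field_simp
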